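/- Let H be a complex Hilbert space, let V : H → H be a pure isometry, let f₀ ∈ ker V*, and let m, n be nonnegative integers with m > n. Then the operator S = V + (Vᵐ f₀)⊗(Vⁿ f₀) is analytic, i.e., ⋂_{k≥0} Sᵏ(H) = {0}. -/

import Mathlib

open ContinuousLinearMap

/-- The rank-one operator `f ⊗ g : h ↦ ⟨h, g⟩ f` (inner product linear in the
first argument, i.e. `⟪g, h⟫ • f` in Mathlib's convention). -/
noncomputable def rankOne {H : Type*} [NormedAddCommGroup H] [InnerProductSpace ℂ H]
    (f g : H) : H →L[ℂ] H :=
  (innerSL ℂ g).smulRight f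

/-- If `V` is an isometry and `f` is in the kernel of its adjoint, then `V ^ n f` is orthogonal
to the range of `V ^ k` for `n < k`. -/
theorem inner_pow_apply_pow_apply_eq_zero
    {H : Type*} [NormedAddCommGroup H] [InnerProductSpace ℂ H] [CompleteSpace H]
    {V : H →L[ℂ] H} (hV : (adjoint V) ∘L V = 1) {f : H} (hf : adjoint V f = 0)
    {n k : ℕ} (hnk : n < k) (x : H) : inner ℂ ((V ^ n) f) ((V ^ k) x) = 0 := by
  induction n generalizing k with
  | zero =>
    obtain ⟨j, rfl⟩ := Nat.exists_eq_add_of_lt hnk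
    rw [pow_succ', mul_apply_eq_comp, ← adjoint_inner_left]
    simp [hf]
  | succ n ih =>
    obtain ⟨j, rfl⟩ := Nat.exists_eq_succ_of_ne_zero (Nat.ne_zero_of_lt hnk)
    rw [pow_succ', pow_succ', mul_apply_eq_comp, mul_apply_eq_comp,
      ← adjoint_inner_left, ← ContinuousLinearMap.comp_apply, hV]
    exact ih (Nat.lt_of_succ_lt_succ hnk)

/-- The perturbation `V + (V ^ m f) ⊗ (V ^ n f)` with `n < m` maps the range of `V ^ k` into the
range of `V ^ (k + 1)`. -/
theorem rankOne_perturbation_apply_mem_range_pow_succ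
    {H : Type*} [NormedAddCommGroup H] [InnerProductSpace ℂ H] [CompleteSpace H]
    {V : H →L[ℂ] H} (hV : (adjoint V) ∘L V = 1) {f : H} (hf : adjoint V f = 0)
    {m n : ℕ} (hmn : n < m) (k : ℕ) (x : H) :
    (V + rankOne ((V ^ m) f) ((V ^ n) f)) ((V ^ k) x) ∈ Set.range ⇑(V ^ (k + 1)) := by
  have happ : (V + rankOne ((V ^ m) f) ((V ^ n) f)) ((V ^ k) x) =
      (V ^ (k + 1)) x + inner ℂ ((V ^ n) f) ((V ^ k) x) • (V ^ m) f := by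
    simp [rankOne, pow_succ' V k]
  rw [happ]
  rcases lt_or_ge n k with h | h
  · rw [inner_pow_apply_pow_apply_eq_zero hV hf h, zero_smul, add_zero]
    exact ⟨x, rfl⟩
  · obtain ⟨j, rfl⟩ := Nat.exists_eq_add_of_le (show k + 1 ≤ m by omega)
    refine ⟨x + inner ℂ ((V ^ n) f) ((V ^ k) x) • (V ^ j) f, ?_⟩
    rw [map_add, map_smul, pow_add V (k + 1) j, mul_apply_eq_comp]

/-- **Proposition.** If `V` is a pure isometry, `f₀ ∈ ker V*` and `m > n`, then
`S = V + (Vᵐ f₀) ⊗ (Vⁿ f₀)` is analytic: `⋂ₖ Sᵏ(H) = {0}`. -/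
theorem analytic_of_rankOne_perturbation_pure_isometry
    {H : Type*} [NormedAddCommGroup H] [InnerProductSpace ℂ H] [CompleteSpace H]
    (V : H →L[ℂ] H) (hV : (adjoint V) ∘L V = 1)
    (hpure : (⋂ k : ℕ, Set.range ⇑(V ^ k)) = {0})
    (f₀ : H) (hf₀ : adjoint V f₀ = 0) (m n : ℕ) (hmn : n < m) :
    (⋂ k : ℕ, Set.range ⇑((V + rankOne ((V ^ m) f₀) ((V ^ n) f₀)) ^ k)) = {0} := by
  have hsub (k : ℕ) (x : H) :
      ((V + rankOne ((V ^ m) f₀) ((V ^ n) f₀)) ^ k) x ∈ Set.range ⇑(V ^ k) := by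
    induction k with
    | zero => exact ⟨x, rfl⟩
    | succ k ih =>
      obtain ⟨y, hy⟩ := ih
      rw [pow_succ' (V + _), mul_apply_eq_comp, ← hy]
      exact rankOne_perturbation_apply_mem_range_pow_succ hV hf₀ hmn k y
  refine Set.Subset.antisymm ?_ ?_
  · rw [← hpure]
    exact Set.iInter_mono fun k => Set.range_subset_iff.2 (hsub k)
  · exact Set.singleton_subset_iff.2 (Set.mem_iInter.2 fun k => ⟨0, map_zero _⟩)
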